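/- For every positive integer N and every integer M ≥ N, for Lebesgue almost every x ∈ [0,1) with N-continued fraction coefficients (a_k), the frequency of M among the coefficients is lim_{n→∞} |{k : 1 ≤ k ≤ n, a_k = M}|/n = (2 ln(M+1) − ln M − ln(M+2))/(ln(N+1) − ln N). -/

import Mathlib

open MeasureTheory Filter Set

/-- The generalized Gauss transformation `T_N(x) = {N/x}` (and `T_N(0) = 0`). -/
noncomputable def gaussT (N : ℕ) (x : ℝ) : ℝ :=
  if x = 0 then 0 else Int.fract ((N : ℝ) / x)

/-- The inverse branch of `gaussT N` on the points whose first coefficient is `N + j`. -/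
noncomputable def gaussBranch (N j : ℕ) (y : ℝ) : ℝ := N / (y + N + j)

/-- The weight of the branch `gaussBranch N j` in the transfer operator of `gaussT N` with respect
to its invariant measure. -/
noncomputable def gaussWeight (N j : ℕ) (y : ℝ) : ℝ := (y + N) / ((y + N + j) * (y + N + j + 1))

/-- The transfer operator of `gaussT N` with respect to its invariant measure. -/
noncomputable def gaussTransfer (N : ℕ) (f : ℝ → ℝ) (y : ℝ) : ℝ :=
  ∑' j, gaussWeight N j y * f (gaussBranch N j y)

variable {N : ℕ} {f : ℝ → ℝ} {x y C δ : ℝ}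

theorem gaussWeight_nonneg (j : ℕ) (hy : 0 ≤ y) : 0 ≤ gaussWeight N j y := by
  unfold gaussWeight; positivity

theorem gaussBranch_mem_Icc (j : ℕ) (hy : 0 ≤ y) : gaussBranch N j y ∈ Icc (0 : ℝ) 1 := by
  unfold gaussBranch
  refine ⟨by positivity, div_le_one_of_le₀ ?_ (by positivity)⟩
  have : (0 : ℝ) ≤ j := by positivity
  linarith

theorem hasSum_gaussWeight (hN : 0 < N) (hy : 0 ≤ y) :
    HasSum (fun j => gaussWeight N j y) 1 := by
  rw [hasSum_iff_tendsto_nat_of_nonneg fun j => gaussWeight_nonneg j hy]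
  have hN' : (0 : ℝ) < N := by exact_mod_cast hN
  have hsum (n : ℕ) : ∑ j ∈ Finset.range n, gaussWeight N j y = 1 - (y + N) / (y + N + n) := by
    induction n with
    | zero => simp [div_self (show y + N ≠ 0 by positivity)]
    | succ n ih =>
      rw [Finset.sum_range_succ, ih, gaussWeight]
      push_cast
      field_simp
      ring
  simp_rw [hsum]
  have : Tendsto (fun n : ℕ => (y + N) / (y + N + n)) atTop (nhds 0) :=
    tendsto_const_nhds.div_atTop
      (tendsto_atTop_add_const_left _ _ tendsto_natCast_atTop_atTop)
  simpa using this.const_sub 1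

theorem summable_gaussTransfer (hN : 0 < N) (hf : ∀ z ∈ Icc (0 : ℝ) 1, |f z| ≤ C) (hy : 0 ≤ y) :
    Summable fun j => gaussWeight N j y * f (gaussBranch N j y) := by
  refine Summable.of_norm_bounded ((hasSum_gaussWeight hN hy).summable.mul_right C) fun j => ?_
  rw [norm_mul, Real.norm_of_nonneg (gaussWeight_nonneg j hy)]
  exact mul_le_mul_of_nonneg_left (hf _ (gaussBranch_mem_Icc j hy)) (gaussWeight_nonneg j hy)

theorem gaussTransfer_mem_Icc {a b : ℝ} (hN : 0 < N) (hf : ∀ z ∈ Icc (0 : ℝ) 1, f z ∈ Icc a b)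
    (hy : 0 ≤ y) : gaussTransfer N f y ∈ Icc a b := by
  have hw := hasSum_gaussWeight hN hy
  have hs : HasSum _ (gaussTransfer N f y) := (summable_gaussTransfer (C := max |a| |b|) hN
    (fun z hz => abs_le_max_abs_abs (hf z hz).1 (hf z hz).2) hy).hasSum
  have hz (j : ℕ) := hf _ (gaussBranch_mem_Icc (N := N) j hy)
  constructor
  · simpa using hasSum_le (fun j => mul_le_mul_of_nonneg_left (hz j).1 (gaussWeight_nonneg j hy))
      (hw.mul_right a) hs
  · simpa using hasSum_le (fun j => mul_le_mul_of_nonneg_left (hz j).2 (gaussWeight_nonneg j hy))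
      hs (hw.mul_right b)

theorem gaussTransfer_neg : gaussTransfer N (fun x => -f x) = fun y => -gaussTransfer N f y := by
  ext y
  simp [gaussTransfer, tsum_neg]

theorem MonotoneOn.abs_le_on_Icc (hf : MonotoneOn f (Icc 0 1)) :
    ∀ z ∈ Icc (0 : ℝ) 1, |f z| ≤ max |f 0| |f 1| := fun z hz =>
  abs_le_max_abs_abs (hf (by simp) hz hz.1) (hf hz (by simp) hz.2)

theorem MonotoneOn.antitoneOn_gaussTransfer (hN : 0 < N) (hf : MonotoneOn f (Icc 0 1)) :
    AntitoneOn (gaussTransfer N f) (Icc 0 1) := by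
  rintro x ⟨hx, -⟩ y ⟨hy, -⟩ hxy
  have hN' : (0 : ℝ) < N := by exact_mod_cast hN
  have hb {i j : ℕ} {s t : ℝ} (hs : 0 ≤ s) (hij : i ≤ j) (hst : s ≤ t) :
      f (gaussBranch N j t) ≤ f (gaussBranch N i s) := by
    refine hf (gaussBranch_mem_Icc _ (hs.trans hst)) (gaussBranch_mem_Icc _ hs) ?_
    have : (i : ℝ) ≤ j := by exact_mod_cast hij
    unfold gaussBranch
    gcongr
  have hex : ∃ j : ℕ, (x + N) * (y + N) < j * (j + 1) := by
    obtain ⟨j, hj⟩ := exists_nat_gt ((x + N) * (y + N))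
    exact ⟨j, by nlinarith [Nat.cast_nonneg (α := ℝ) j]⟩
  classical
  obtain ⟨J, hJ, hlt⟩ : ∃ J : ℕ, (x + N) * (y + N) < J * (J + 1) ∧
      ∀ j < J, ¬ (x + N) * (y + N) < j * (j + 1) :=
    ⟨Nat.find hex, Nat.find_spec hex, fun j => Nat.find_min hex⟩
  have hdiff (j : ℕ) : gaussWeight N j x - gaussWeight N j y =
      (y - x) * ((x + N) * (y + N) - j * (j + 1)) /
        (((x + N + j) * (x + N + j + 1)) * ((y + N + j) * (y + N + j + 1))) := by
    unfold gaussWeight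
    field_simp
    ring
  set v := f (gaussBranch N J x)
  have hx' := ((summable_gaussTransfer hN hf.abs_le_on_Icc hx).hasSum).sub
    ((hasSum_gaussWeight hN hx).mul_right v)
  have hy' := ((summable_gaussTransfer hN hf.abs_le_on_Icc hy).hasSum).sub
    ((hasSum_gaussWeight hN hy).mul_right v)
  refine (sub_le_sub_iff_right _).1 (hasSum_le (fun j => ?_) hy' hx')
  have h1 := mul_le_mul_of_nonneg_left (hb hx (le_refl j) hxy)
    (gaussWeight_nonneg (N := N) j hy)
  have h2 : 0 ≤ (gaussWeight N j x - gaussWeight N j y) * (f (gaussBranch N j x) - v) := by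
    rw [hdiff]
    rcases lt_or_ge j J with h | h
    · refine mul_nonneg (div_nonneg (mul_nonneg (sub_nonneg.2 hxy) ?_) (by positivity))
        (sub_nonneg.2 (hb hx h.le le_rfl))
      linarith [hlt j h]
    · refine mul_nonneg_of_nonpos_of_nonpos (div_nonpos_of_nonpos_of_nonneg
        (mul_nonpos_of_nonneg_of_nonpos (sub_nonneg.2 hxy) ?_) (by positivity))
        (sub_nonpos.2 (hb hx h le_rfl))
      have : (J : ℝ) ≤ j := by exact_mod_cast h
      nlinarith [Nat.cast_nonneg (α := ℝ) J]
  linarith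

theorem MonotoneOn.gaussTransfer_sub_le (hN : 0 < N) (hf : MonotoneOn f (Icc 0 1)) :
    gaussTransfer N f 0 - gaussTransfer N f 1 ≤ (f 1 - f 0) / 2 := by
  have hN' : (1 : ℝ) ≤ N := by exact_mod_cast hN
  have h01 : gaussTransfer N f 0 = f 1 / (N + 1) + N / (N + 1) * gaussTransfer N f 1 := by
    rw [gaussTransfer, (summable_gaussTransfer hN hf.abs_le_on_Icc le_rfl).tsum_eq_zero_add,
      gaussTransfer, ← tsum_mul_left]
    congr 1
    · simp only [gaussWeight, gaussBranch]
      simp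
      field_simp
    · refine tsum_congr fun j => ?_
      have : gaussBranch N (j + 1) 0 = gaussBranch N j 1 := by
        simp only [gaussBranch]
        push_cast
        ring_nf
      rw [this, ← mul_assoc]
      congr 1
      simp only [gaussWeight]
      push_cast
      field_simp
      ring
  have hmem := (gaussTransfer_mem_Icc (a := f 0) (b := f 1) hN
    (fun z hz => ⟨hf (by simp) hz hz.1, hf hz (by simp) hz.2⟩) zero_le_one).1
  have h : gaussTransfer N f 0 - gaussTransfer N f 1 =
      (f 1 - gaussTransfer N f 1) / (N + 1) := by
    rw [h01]
    field_simp
    ring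
  rw [h]
  have h0 : f 0 ≤ f 1 := hf (by simp) (by simp) zero_le_one
  gcongr
  linarith

/-- The function `f` is monotone or antitone on `[0, 1]`, with oscillation at most `δ`. -/
def MonotoneOscLE (f : ℝ → ℝ) (δ : ℝ) : Prop :=
  (MonotoneOn f (Icc 0 1) ∧ f 1 - f 0 ≤ δ) ∨ (AntitoneOn f (Icc 0 1) ∧ f 0 - f 1 ≤ δ)

theorem MonotoneOscLE.abs_sub_le (hf : MonotoneOscLE f δ) (hx : x ∈ Icc (0 : ℝ) 1)
    (hy : y ∈ Icc (0 : ℝ) 1) : |f x - f y| ≤ δ := by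
  have h0 : (0 : ℝ) ∈ Icc (0 : ℝ) 1 := by simp
  have h1 : (1 : ℝ) ∈ Icc (0 : ℝ) 1 := by simp
  rw [abs_le]
  rcases hf with ⟨hf, h⟩ | ⟨hf, h⟩ <;>
    constructor <;>
    linarith [hf h0 hx hx.1, hf h0 hy hy.1, hf hx h1 hx.2, hf hy h1 hy.2]

theorem MonotoneOscLE.gaussTransfer (hN : 0 < N) (hf : MonotoneOscLE f δ) :
    MonotoneOscLE (gaussTransfer N f) (δ / 2) := by
  rcases hf with ⟨hf, h⟩ | ⟨hf, h⟩
  · exact .inr ⟨hf.antitoneOn_gaussTransfer hN, (hf.gaussTransfer_sub_le hN).trans (by linarith)⟩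
  · have h1 := hf.neg.antitoneOn_gaussTransfer hN
    have h2 := hf.neg.gaussTransfer_sub_le hN
    rw [gaussTransfer_neg] at h1 h2
    refine .inl ⟨by simpa using h1.neg, ?_⟩
    linarith

theorem measurable_gaussT : Measurable (gaussT N) :=
  Measurable.ite (measurableSet_singleton 0) measurable_const
    (measurable_fract.comp (measurable_const.div measurable_id))

theorem gaussT_gaussBranch (hN : 0 < N) (j : ℕ) (hy : y ∈ Ico (0 : ℝ) 1) :
    gaussT N (gaussBranch N j y) = y := by
  have hN' : (0 : ℝ) < N := by exact_mod_cast hN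
  have hy0 := hy.1
  have hne : gaussBranch N j y ≠ 0 := by unfold gaussBranch; positivity
  rw [gaussT, if_neg hne, gaussBranch, div_div_cancel₀ hN'.ne', Int.fract_add_natCast,
    Int.fract_add_natCast, Int.fract_eq_self.2 hy]

theorem injOn_gaussBranch (hN : 0 < N) (j : ℕ) : InjOn (gaussBranch N j) (Ico 0 1) :=
  fun x hx y hy h => by rw [← gaussT_gaussBranch hN j hx, h, gaussT_gaussBranch hN j hy]

theorem hasDerivAt_gaussBranch (hN : 0 < N) (j : ℕ) (hy : 0 ≤ y) :
    HasDerivAt (gaussBranch N j) (-(N / (y + N + j) ^ 2)) y := by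
  have hN' : (0 : ℝ) < N := by exact_mod_cast hN
  have h := ((((hasDerivAt_id y).add_const (N : ℝ)).add_const (j : ℝ)).inv
    (by simp only [id]; positivity)).const_mul (N : ℝ)
  refine (h.congr_deriv ?_).congr_of_eventuallyEq (.of_forall fun x => ?_)
  · simp only [id]
    ring
  · simp [gaussBranch, div_eq_mul_inv]

theorem iUnion_gaussBranch_image (hN : 0 < N) :
    ⋃ j, gaussBranch N j '' Ico 0 1 = Ioc 0 1 := by
  have hN' : (0 : ℝ) < N := by exact_mod_cast hN
  ext x
  simp only [mem_iUnion, mem_image]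
  constructor
  · rintro ⟨j, y, hy, rfl⟩
    have hy0 := hy.1
    exact ⟨by unfold gaussBranch; positivity, (gaussBranch_mem_Icc j hy.1).2⟩
  · rintro ⟨h0, h1⟩
    have hle : (N : ℝ) ≤ N / x := by
      rw [le_div_iff₀ h0]
      nlinarith
    have hfl := Nat.le_floor hle
    refine ⟨⌊(N : ℝ) / x⌋₊ - N, N / x - ⌊(N : ℝ) / x⌋₊,
      ⟨sub_nonneg.2 (Nat.floor_le (by positivity)), ?_⟩, ?_⟩
    · linarith [Nat.lt_floor_add_one ((N : ℝ) / x)]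
    · rw [gaussBranch, Nat.cast_sub hfl, add_assoc, add_sub_cancel, sub_add_cancel,
        div_div_cancel₀ hN'.ne']

theorem pairwise_disjoint_gaussBranch_image (hN : 0 < N) :
    Pairwise (Function.onFun Disjoint fun j => gaussBranch N j '' Ico 0 1) := by
  have hN' : (0 : ℝ) < N := by exact_mod_cast hN
  intro i j hij
  rw [Function.onFun, Set.disjoint_left]
  rintro _ ⟨x, hx, rfl⟩ ⟨y, hy, h⟩
  have hxy : y = x := by rw [← gaussT_gaussBranch hN j hy, h, gaussT_gaussBranch hN i hx]
  subst hxy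
  have hy0 := hy.1
  rw [gaussBranch, gaussBranch, div_eq_div_iff (by positivity) (by positivity)] at h
  replace h := mul_left_cancel₀ hN'.ne' h
  exact hij (by exact_mod_cast add_left_cancel h)

theorem lintegral_eq_tsum_gaussBranch (hN : 0 < N) (Φ : ℝ → ENNReal) :
    ∫⁻ x in Ico 0 1, Φ x = ∑' j : ℕ, ∫⁻ y in Ico (0 : ℝ) 1,
      ENNReal.ofReal (N / (y + N + j) ^ 2) * Φ (gaussBranch N j y) := by
  have hd (j : ℕ) : ∀ y ∈ Ico (0 : ℝ) 1, HasDerivAt (gaussBranch N j) (-(N / (y + N + j) ^ 2)) y :=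
    fun y hy => hasDerivAt_gaussBranch hN j hy.1
  have hIoc : ∫⁻ x in Ico 0 1, Φ x = ∫⁻ x in ⋃ j, gaussBranch N j '' Ico 0 1, Φ x := by
    rw [iUnion_gaussBranch_image hN, Measure.restrict_congr_set Ico_ae_eq_Ioc]
  rw [hIoc, lintegral_iUnion
    (fun j => measurableSet_Ico.image_of_continuousOn_injOn
      (fun y hy => (hd j y hy).continuousAt.continuousWithinAt) (injOn_gaussBranch hN j))
    (pairwise_disjoint_gaussBranch_image hN)]
  refine tsum_congr fun j => ?_
  rw [lintegral_image_eq_lintegral_abs_deriv_mul measurableSet_Ico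
    (fun y hy => (hd j y hy).hasDerivWithinAt) (injOn_gaussBranch hN j)]
  refine setLIntegral_congr_fun measurableSet_Ico fun y hy => ?_
  have hy0 := hy.1
  simp only [abs_neg]
  rw [abs_of_nonneg (by positivity)]

/-- The density of the invariant probability measure of `gaussT N`. -/
noncomputable def gaussDensity (N : ℕ) (x : ℝ) : ℝ :=
  1 / ((x + N) * (Real.log (N + 1) - Real.log N))

/-- The invariant probability measure of `gaussT N`. -/
noncomputable def gaussMeasure (N : ℕ) : Measure ℝ :=
  (volume.restrict (Ico 0 1)).withDensity fun x => ENNReal.ofReal (gaussDensity N x)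

theorem log_add_one_sub_log_pos (hN : 0 < N) : 0 < Real.log (N + 1) - Real.log N :=
  sub_pos.2 (Real.log_lt_log (by exact_mod_cast hN) (lt_add_one _))

theorem gaussDensity_pos (hN : 0 < N) (hx : 0 ≤ x) : 0 < gaussDensity N x := by
  have hN' : (0 : ℝ) < N := by exact_mod_cast hN
  have := log_add_one_sub_log_pos hN
  unfold gaussDensity
  positivity

theorem measurable_gaussDensity : Measurable (gaussDensity N) := by
  unfold gaussDensity
  fun_prop

theorem ae_gaussMeasure_mem : ∀ᵐ x ∂gaussMeasure N, x ∈ Ico (0 : ℝ) 1 :=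
  (withDensity_absolutelyContinuous _ _).ae_le (ae_restrict_mem measurableSet_Ico)

theorem volume_absolutelyContinuous_gaussMeasure (hN : 0 < N) :
    volume.restrict (Ico (0 : ℝ) 1) ≪ gaussMeasure N := by
  refine withDensity_absolutelyContinuous' measurable_gaussDensity.ennreal_ofReal.aemeasurable ?_
  filter_upwards [ae_restrict_mem measurableSet_Ico] with x hx
  simpa using gaussDensity_pos hN hx.1

theorem lintegral_gaussMeasure {Φ : ℝ → ENNReal} (hΦ : Measurable Φ) :
    ∫⁻ x, Φ x ∂gaussMeasure N =
      ∫⁻ x in Ico 0 1, ENNReal.ofReal (gaussDensity N x) * Φ x :=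
  lintegral_withDensity_eq_lintegral_mul _ measurable_gaussDensity.ennreal_ofReal hΦ

theorem gaussMeasure_Ioc (hN : 0 < N) {a b : ℝ} (ha : 0 ≤ a) (hab : a ≤ b) (hb : b ≤ 1) :
    gaussMeasure N (Ioc a b) = ENNReal.ofReal ((Real.log (b + N) - Real.log (a + N)) /
      (Real.log (N + 1) - Real.log N)) := by
  have hN' : (0 : ℝ) < N := by exact_mod_cast hN
  have hinter : (Ioc a b ∩ Ico 0 1 : Set ℝ) =ᵐ[volume] Ioc a b := by
    have : (Ioc a b ∩ Ioc 0 1 : Set ℝ) = Ioc a b :=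
      inter_eq_left.2 (Ioc_subset_Ioc ha hb)
    exact ((ae_eq_refl (Ioc a b)).inter Ico_ae_eq_Ioc).trans this.eventuallyEq
  have hderiv : ∀ x ∈ uIcc a b, HasDerivAt
      (fun x => Real.log (x + N) / (Real.log (N + 1) - Real.log N)) (gaussDensity N x) x := by
    intro x hx
    rw [uIcc_of_le hab] at hx
    have hx0 : x + N ≠ 0 := by linarith [hx.1]
    refine ((((hasDerivAt_id x).add_const (N : ℝ)).log hx0).div_const _).congr_deriv ?_
    rw [gaussDensity, div_div]
    rfl
  have hcont : ContinuousOn (gaussDensity N) (Icc a b) := by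
    unfold gaussDensity
    have := log_add_one_sub_log_pos hN
    refine continuousOn_const.div (by fun_prop) fun x hx => ?_
    have := ha.trans hx.1
    positivity
  have hInt : IntervalIntegrable (gaussDensity N) volume a b := by
    rw [← uIcc_of_le hab] at hcont
    exact hcont.intervalIntegrable
  rw [gaussMeasure, withDensity_apply _ measurableSet_Ioc,
    Measure.restrict_restrict measurableSet_Ioc, Measure.restrict_congr_set hinter,
    ← ofReal_integral_eq_lintegral_ofReal hInt.1
      ((ae_restrict_mem measurableSet_Ioc).mono fun x hx =>
        (gaussDensity_pos hN (ha.trans hx.1.le)).le),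
    ← intervalIntegral.integral_of_le hab,
    intervalIntegral.integral_eq_sub_of_hasDerivAt hderiv hInt, sub_div]

theorem isProbabilityMeasure_gaussMeasure (hN : 0 < N) :
    IsProbabilityMeasure (gaussMeasure N) := by
  have h := gaussMeasure_Ioc hN le_rfl zero_le_one le_rfl
  have hae : (univ : Set ℝ) =ᵐ[gaussMeasure N] Ioc 0 1 := by
    have h0 : ∀ᵐ x ∂gaussMeasure N, x ≠ 0 :=
      (withDensity_absolutelyContinuous _ _).ae_le (ae_restrict_of_ae (Measure.ae_ne volume 0))
    filter_upwards [ae_gaussMeasure_mem, h0] with x hx hx0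
    exact propext ⟨fun _ => ⟨hx.1.lt_of_ne' hx0, hx.2.le⟩, fun _ => trivial⟩
  refine ⟨?_⟩
  rw [measure_congr hae, h, zero_add, add_comm, div_self (log_add_one_sub_log_pos hN).ne',
    ENNReal.ofReal_one]

theorem measurable_gaussTransfer (hf : Measurable f) : Measurable (gaussTransfer N f) := by
  unfold gaussTransfer gaussWeight gaussBranch
  exact Measurable.tsum fun j => by fun_prop

theorem lintegral_mul_comp_gaussT (hN : 0 < N) {g : ℝ → ℝ} (hf : Measurable f)
    (hg : Measurable g) (hf01 : ∀ z ∈ Icc (0 : ℝ) 1, f z ∈ Icc (0 : ℝ) 1) (hg0 : ∀ z, 0 ≤ g z) :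
    ∫⁻ x, ENNReal.ofReal (f x * g (gaussT N x)) ∂gaussMeasure N =
      ∫⁻ y, ENNReal.ofReal (gaussTransfer N f y * g y) ∂gaussMeasure N := by
  have hN' : (0 : ℝ) < N := by exact_mod_cast hN
  have hfg : Measurable fun x => f x * g (gaussT N x) := hf.mul (hg.comp measurable_gaussT)
  rw [lintegral_gaussMeasure hfg.ennreal_ofReal,
    lintegral_gaussMeasure (Φ := fun y => ENNReal.ofReal (gaussTransfer N f y * g y))
      ((measurable_gaussTransfer hf).mul hg).ennreal_ofReal,
    lintegral_eq_tsum_gaussBranch hN]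
  have hterm (j : ℕ) : ∫⁻ y in Ico (0 : ℝ) 1, ENNReal.ofReal (N / (y + N + j) ^ 2) *
      (ENNReal.ofReal (gaussDensity N (gaussBranch N j y)) *
        ENNReal.ofReal (f (gaussBranch N j y) * g (gaussT N (gaussBranch N j y)))) =
      ∫⁻ y in Ico (0 : ℝ) 1, ENNReal.ofReal (gaussDensity N y) *
        ENNReal.ofReal (gaussWeight N j y * f (gaussBranch N j y) * g y) := by
    refine setLIntegral_congr_fun measurableSet_Ico fun y hy => ?_
    have hy0 := hy.1
    have hL := log_add_one_sub_log_pos hN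
    have hb := gaussBranch_mem_Icc (N := N) j hy0
    rw [gaussT_gaussBranch hN j hy, ← ENNReal.ofReal_mul (gaussDensity_pos hN hb.1).le,
      ← ENNReal.ofReal_mul (by positivity), ← ENNReal.ofReal_mul (gaussDensity_pos hN hy0).le]
    congr 1
    have : N / (y + N + j) ^ 2 * gaussDensity N (gaussBranch N j y) =
        gaussDensity N y * gaussWeight N j y := by
      unfold gaussDensity gaussWeight gaussBranch
      field_simp
      ring
    rw [← mul_assoc, this]
    ring
  rw [tsum_congr hterm, ← lintegral_tsum fun j => ?_]
  · refine setLIntegral_congr_fun measurableSet_Ico fun y hy => ?_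
    rw [ENNReal.tsum_mul_left, gaussTransfer, ← tsum_mul_right, ENNReal.ofReal_tsum_of_nonneg]
    · intro j
      exact mul_nonneg (mul_nonneg (gaussWeight_nonneg j hy.1)
        (hf01 _ (gaussBranch_mem_Icc j hy.1)).1) (hg0 y)
    · exact (summable_gaussTransfer (C := 1) hN (fun z hz => by
        rw [abs_of_nonneg (hf01 z hz).1]
        exact (hf01 z hz).2) hy.1).mul_right _
  · have := measurable_gaussDensity (N := N)
    unfold gaussWeight gaussBranch
    fun_prop

theorem integral_mul_comp_gaussT (hN : 0 < N) {g : ℝ → ℝ} (hf : Measurable f)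
    (hg : Measurable g) (hf01 : ∀ z ∈ Icc (0 : ℝ) 1, f z ∈ Icc (0 : ℝ) 1) (hg0 : ∀ z, 0 ≤ g z) :
    ∫ x, f x * g (gaussT N x) ∂gaussMeasure N =
      ∫ y, gaussTransfer N f y * g y ∂gaussMeasure N := by
  rw [integral_eq_lintegral_of_nonneg_ae, integral_eq_lintegral_of_nonneg_ae,
    lintegral_mul_comp_gaussT hN hf hg hf01 hg0]
  · filter_upwards [ae_gaussMeasure_mem] with x hx
    exact mul_nonneg (gaussTransfer_mem_Icc hN hf01 hx.1).1 (hg0 _)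
  · exact ((measurable_gaussTransfer hf).mul hg).aestronglyMeasurable
  · filter_upwards [ae_gaussMeasure_mem] with x hx
    exact mul_nonneg (hf01 x ⟨hx.1, hx.2.le⟩).1 (hg0 _)
  · exact (hf.mul (hg.comp measurable_gaussT)).aestronglyMeasurable

theorem integral_mul_comp_iterate_sub_le (hN : 0 < N) {g : ℝ → ℝ} (hg : Measurable g)
    (hg01 : ∀ z, g z ∈ Icc (0 : ℝ) 1) (n : ℕ) (hf : Measurable f)
    (hf01 : ∀ z ∈ Icc (0 : ℝ) 1, f z ∈ Icc (0 : ℝ) 1) (hosc : MonotoneOscLE f δ) :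
    |∫ x, f x * g ((gaussT N)^[n] x) ∂gaussMeasure N -
      (∫ x, f x ∂gaussMeasure N) * ∫ x, g x ∂gaussMeasure N| ≤ δ / 2 ^ n := by
  have := isProbabilityMeasure_gaussMeasure hN
  induction n generalizing f δ with
  | zero =>
    have hfi : Integrable f (gaussMeasure N) := by
      refine .of_bound hf.aestronglyMeasurable 1 (ae_gaussMeasure_mem.mono fun x hx => ?_)
      have h := hf01 x (Ico_subset_Icc_self hx)
      rw [Real.norm_of_nonneg h.1]
      exact h.2
    have hgi : Integrable g (gaussMeasure N) := by
      refine .of_bound hg.aestronglyMeasurable 1 (.of_forall fun x => ?_)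
      rw [Real.norm_of_nonneg (hg01 x).1]
      exact (hg01 x).2
    have hfg : Integrable (fun x => f x * g x) (gaussMeasure N) := by
      refine hfi.mul_bdd (c := 1) hg.aestronglyMeasurable (.of_forall fun x => ?_)
      rw [Real.norm_of_nonneg (hg01 x).1]
      exact (hg01 x).2
    have hmean {x : ℝ} (hx : x ∈ Icc (0 : ℝ) 1) : |f x - ∫ y, f y ∂gaussMeasure N| ≤ δ := by
      have h : f x - ∫ y, f y ∂gaussMeasure N = ∫ y, (f x - f y) ∂gaussMeasure N := by
        rw [integral_sub (integrable_const _) hfi]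
        simp
      rw [h, ← Real.norm_eq_abs]
      refine (norm_integral_le_of_norm_le_const (C := δ)
        (ae_gaussMeasure_mem.mono fun y hy => ?_)).trans (by simp)
      exact hosc.abs_sub_le hx (Ico_subset_Icc_self hy)
    have h : ∫ x, f x * g x ∂gaussMeasure N -
        (∫ x, f x ∂gaussMeasure N) * ∫ x, g x ∂gaussMeasure N =
        ∫ x, (f x - ∫ y, f y ∂gaussMeasure N) * g x ∂gaussMeasure N := by
      simp_rw [sub_mul]
      rw [integral_sub hfg (hgi.const_mul _), integral_const_mul]
    simp only [Function.iterate_zero, id, pow_zero, div_one]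
    rw [h, ← Real.norm_eq_abs]
    refine (norm_integral_le_of_norm_le_const (C := δ)
      (ae_gaussMeasure_mem.mono fun y hy => ?_)).trans (by simp)
    have hm := hmean (Ico_subset_Icc_self hy)
    rw [norm_mul, Real.norm_of_nonneg (hg01 y).1]
    exact (mul_le_of_le_one_right (norm_nonneg _) (hg01 y).2).trans hm
  | succ n ih =>
    have h1 := integral_mul_comp_gaussT hN (g := fun x => g ((gaussT N)^[n] x)) hf
      (hg.comp (measurable_gaussT.iterate n)) hf01 fun z => (hg01 _).1
    have h2 := integral_mul_comp_gaussT hN (g := fun _ => 1) hf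
      measurable_const hf01 fun z => zero_le_one
    simp only [mul_one] at h2
    simp only [Function.iterate_succ_apply]
    rw [h1, h2, pow_succ', ← div_div]
    exact ih (measurable_gaussTransfer hf)
      (fun z hz => gaussTransfer_mem_Icc hN hf01 hz.1) (hosc.gaussTransfer hN)

theorem measurePreserving_gaussT (hN : 0 < N) :
    MeasurePreserving (gaussT N) (gaussMeasure N) (gaussMeasure N) := by
  refine ⟨measurable_gaussT, Measure.ext fun s hs => ?_⟩
  have h := lintegral_mul_comp_gaussT hN (f := fun _ => 1) (g := s.indicator 1) measurable_const
    (measurable_one.indicator hs) (fun _ _ => by simp)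
    (fun z => indicator_nonneg (fun _ _ => zero_le_one) z)
  have hind (z : ℝ) : ENNReal.ofReal (s.indicator 1 z) = s.indicator 1 z := by
    by_cases hz : z ∈ s <;> simp [hz]
  have hone : ∀ᵐ y ∂gaussMeasure N,
      ENNReal.ofReal (gaussTransfer N (fun _ => 1) y * s.indicator 1 y) = s.indicator 1 y := by
    filter_upwards [ae_gaussMeasure_mem] with y hy
    have h1 := gaussTransfer_mem_Icc (a := 1) (b := 1) (f := fun _ => 1) hN
      (fun _ _ => by simp) hy.1
    rw [le_antisymm h1.2 h1.1, one_mul, hind]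
  rw [lintegral_congr_ae hone, lintegral_indicator_one hs] at h
  simp only [one_mul, hind] at h
  rw [← h, ← lintegral_indicator_one hs,
    lintegral_map (measurable_one.indicator hs) measurable_gaussT]

section Correlation

variable {α : Type*} [MeasurableSpace α] {μ : Measure α} [IsProbabilityMeasure μ] {T : α → α}

theorem integral_sq_sum_comp_iterate_le (hT : MeasurePreserving T μ μ) {ψ : α → ℝ}
    (hψ : Measurable ψ) (hψ1 : ∀ x, |ψ x| ≤ 1)
    (hC : ∀ n, |∫ x, ψ x * ψ (T^[n] x) ∂μ| ≤ C / 2 ^ n) (n : ℕ) :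
    ∫ x, (∑ k ∈ Finset.range n, ψ (T^[k] x)) ^ 2 ∂μ ≤ 3 * C * n := by
  have hC0 : 0 ≤ C := by simpa using (abs_nonneg _).trans (hC 0)
  have hm (k : ℕ) : Measurable fun x => ψ (T^[k] x) := hψ.comp (hT.measurable.iterate k)
  have hInt (j k : ℕ) : Integrable (fun x => ψ (T^[j] x) * ψ (T^[k] x)) μ := by
    refine .of_bound ((hm j).mul (hm k)).aestronglyMeasurable 1 (.of_forall fun x => ?_)
    rw [norm_mul]
    exact mul_le_one₀ (hψ1 _) (norm_nonneg _) (hψ1 _)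
  have hcorr (j k : ℕ) : ∫ x, ψ (T^[j] x) * ψ (T^[j + k] x) ∂μ ≤ C / 2 ^ k := by
    have h := integral_map (μ := μ) (hT.iterate j).aemeasurable (f := fun x => ψ x * ψ (T^[k] x))
      (hψ.mul (hm k)).aestronglyMeasurable
    rw [(hT.iterate j).map_eq] at h
    simp_rw [add_comm j k, Function.iterate_add_apply]
    rw [← h]
    exact (le_abs_self _).trans (hC k)
  have hgeom (n : ℕ) : ∑ k ∈ Finset.range n, C / 2 ^ (n - k) ≤ C := by
    have : ∑ k ∈ Finset.range n, C / 2 ^ (n - k) = C - C / 2 ^ n := by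
      induction n with
      | zero => simp
      | succ n ih =>
        rw [Finset.sum_range_succ']
        simp only [Nat.reduceSubDiff, ih, Nat.sub_zero, pow_succ]
        field_simp
        ring
    rw [this]
    exact sub_le_self _ (by positivity)
  have hsum (n : ℕ) (x : α) : (∑ k ∈ Finset.range n, ψ (T^[k] x)) ^ 2 =
      ∑ j ∈ Finset.range n, ∑ k ∈ Finset.range n, ψ (T^[j] x) * ψ (T^[k] x) := by
    rw [sq, Finset.sum_mul_sum]
  have hsq (n : ℕ) : Integrable (fun x => (∑ k ∈ Finset.range n, ψ (T^[k] x)) ^ 2) μ := by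
    simp_rw [hsum]
    exact integrable_finsetSum _ fun j _ => integrable_finsetSum _ fun k _ => hInt j k
  induction n with
  | zero => simp
  | succ n ih =>
    have hexp (x : α) : (∑ k ∈ Finset.range (n + 1), ψ (T^[k] x)) ^ 2 =
        (∑ k ∈ Finset.range n, ψ (T^[k] x)) ^ 2 +
          (2 * (∑ k ∈ Finset.range n, ψ (T^[k] x) * ψ (T^[n] x)) + ψ (T^[n] x) * ψ (T^[n] x)) := by
      rw [Finset.sum_range_succ, ← Finset.sum_mul]
      ring
    have hcross : Integrable (fun x => ∑ k ∈ Finset.range n, ψ (T^[k] x) * ψ (T^[n] x)) μ :=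
      integrable_finsetSum _ fun k _ => hInt k n
    have hle : ∑ k ∈ Finset.range n, ∫ x, ψ (T^[k] x) * ψ (T^[n] x) ∂μ ≤ C := by
      refine (Finset.sum_le_sum fun k hk => ?_).trans (hgeom n)
      simpa [Nat.add_sub_cancel' (Finset.mem_range.1 hk).le] using hcorr k (n - k)
    have hrest : Integrable (fun x => 2 * (∑ k ∈ Finset.range n, ψ (T^[k] x) * ψ (T^[n] x)) +
        ψ (T^[n] x) * ψ (T^[n] x)) μ := (hcross.const_mul 2).add (hInt n n)
    simp_rw [hexp]
    rw [integral_add (hsq n) hrest,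
      integral_add (hcross.const_mul 2) (hInt n n), integral_const_mul,
      integral_finsetSum _ fun k _ => hInt k n]
    have h0 := hcorr n 0
    simp only [add_zero, pow_zero, div_one] at h0
    push_cast
    linarith

/-- Exponential decay of correlations implies that the time averages converge almost everywhere. -/
theorem ae_tendsto_average_of_correlation_le (hT : MeasurePreserving T μ μ) {φ : α → ℝ}
    (hφ : Measurable φ) (hφ01 : ∀ x, φ x ∈ Icc (0 : ℝ) 1)
    (hC : ∀ n, |∫ x, φ x * φ (T^[n] x) ∂μ - (∫ x, φ x ∂μ) ^ 2| ≤ C / 2 ^ n) :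
    ∀ᵐ x ∂μ, Tendsto (fun n : ℕ => (∑ k ∈ Finset.range n, φ (T^[k] x)) / n) atTop
      (nhds (∫ x, φ x ∂μ)) := by
  set p := ∫ x, φ x ∂μ with hp
  have hm (k : ℕ) : Measurable fun x => φ (T^[k] x) := hφ.comp (hT.measurable.iterate k)
  have hnorm (x : α) : ‖φ x‖ ≤ 1 := by
    rw [Real.norm_of_nonneg (hφ01 x).1]
    exact (hφ01 x).2
  have hInt (k : ℕ) : Integrable (fun x => φ (T^[k] x)) μ :=
    .of_bound (hm k).aestronglyMeasurable 1 (.of_forall fun x => hnorm _)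
  have hp0 : 0 ≤ p := integral_nonneg fun x => (hφ01 x).1
  have hp1 : p ≤ 1 := by
    simpa using integral_mono (hInt 0) (integrable_const 1) fun x => (hφ01 _).2
  set ψ : α → ℝ := fun x => φ x - p with hψ
  have hψm : Measurable ψ := hφ.sub_const p
  have hψ1 (x : α) : |ψ x| ≤ 1 := by
    have := hφ01 x
    rw [abs_le]
    constructor <;> simp only [hψ] <;> linarith [this.1, this.2]
  have hψC (n : ℕ) : |∫ x, ψ x * ψ (T^[n] x) ∂μ| ≤ C / 2 ^ n := by
    have hTn : ∫ x, φ (T^[n] x) ∂μ = p := by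
      have h := integral_map (μ := μ) (hT.iterate n).aemeasurable (f := φ) hφ.aestronglyMeasurable
      rw [(hT.iterate n).map_eq] at h
      exact h.symm
    have hprod : Integrable (fun x => φ x * φ (T^[n] x)) μ :=
      (hInt 0).mul_bdd (c := 1) (hm n).aestronglyMeasurable (.of_forall fun x => hnorm _)
    have hexp (x : α) : ψ x * ψ (T^[n] x) =
        φ x * φ (T^[n] x) - (p * φ x + (p * φ (T^[n] x) - p ^ 2)) := by
      simp only [hψ]
      ring
    have h : ∫ x, ψ x * ψ (T^[n] x) ∂μ = ∫ x, φ x * φ (T^[n] x) ∂μ - p ^ 2 := by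
      have h0 : Integrable (fun x => p * φ x) μ := (hInt 0).const_mul p
      have h1 : Integrable (fun x => p * φ (T^[n] x) - p ^ 2) μ :=
        ((hInt n).const_mul p).sub (integrable_const _)
      have h2 : Integrable (fun x => p * φ x + (p * φ (T^[n] x) - p ^ 2)) μ := h0.add h1
      simp_rw [hexp]
      rw [integral_sub hprod h2, integral_add h0 h1,
        integral_sub ((hInt n).const_mul p) (integrable_const _),
        integral_const_mul, integral_const_mul, hTn, ← hp]
      simp
      ring
    rw [h]
    exact hC n
  have hSm (n : ℕ) : Measurable fun x => (∑ k ∈ Finset.range n, ψ (T^[k] x)) :=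
    Finset.measurable_sum _ fun k _ => hψm.comp (hT.measurable.iterate k)
  have hvar (n : ℕ) : ∫⁻ x, ENNReal.ofReal
      (((∑ k ∈ Finset.range (n ^ 2), ψ (T^[k] x)) / (n ^ 2 : ℕ)) ^ 2) ∂μ ≤
        ENNReal.ofReal (3 * C * (1 / (n : ℝ) ^ 2)) := by
    rw [← ofReal_integral_eq_lintegral_ofReal]
    · refine ENNReal.ofReal_le_ofReal ?_
      simp_rw [div_pow]
      rw [integral_div]
      rcases n.eq_zero_or_pos with rfl | hn
      · simp
      · have := integral_sq_sum_comp_iterate_le hT hψm hψ1 hψC (n ^ 2)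
        rw [div_le_iff₀ (by positivity)]
        refine this.trans_eq ?_
        push_cast
        field_simp
    · refine .of_bound ((hSm _).div_const _ |>.pow_const 2).aestronglyMeasurable 1
        (.of_forall fun x => ?_)
      rw [norm_pow, norm_div, Real.norm_natCast]
      refine pow_le_one₀ (by positivity) (div_le_one_of_le₀ ?_ (by positivity))
      refine (norm_sum_le_of_le _ fun k _ => hψ1 (T^[k] x)).trans (by simp)
    · exact .of_forall fun x => sq_nonneg _
  have hfin : ∀ᵐ x ∂μ, ∑' n : ℕ, ENNReal.ofReal
      (((∑ k ∈ Finset.range (n ^ 2), ψ (T^[k] x)) / (n ^ 2 : ℕ)) ^ 2) < ⊤ := by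
    have hmeas (n : ℕ) : Measurable fun x => ENNReal.ofReal
        (((∑ k ∈ Finset.range (n ^ 2), ψ (T^[k] x)) / (n ^ 2 : ℕ)) ^ 2) :=
      ((hSm _).div_const _ |>.pow_const 2).ennreal_ofReal
    refine ae_lt_top (Measurable.tsum hmeas) ?_
    rw [lintegral_tsum fun n => (hmeas n).aemeasurable]
    refine ne_top_of_le_ne_top ?_ (ENNReal.tsum_le_tsum hvar)
    exact ((Real.summable_one_div_nat_pow.2 one_lt_two).mul_left (3 * C)).tsum_ofReal_ne_top
  filter_upwards [hfin] with x hx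
  refine tendsto_div_of_monotone_of_exists_subseq_tendsto_div _ _ ?_ fun a ha =>
    ⟨fun n => n ^ 2, ?_, tendsto_pow_atTop two_ne_zero, ?_⟩
  · exact monotone_nat_of_le_succ fun n => by
      rw [Finset.sum_range_succ]
      exact le_add_of_nonneg_right (hφ01 _).1
  · obtain ⟨m, hm⟩ := exists_nat_gt (3 / (a - 1))
    filter_upwards [eventually_ge_atTop (max m 1)] with n hn
    have hn1 : (1 : ℝ) ≤ n := by exact_mod_cast (le_max_right m 1).trans hn
    have hnm : (m : ℝ) ≤ n := by exact_mod_cast (le_max_left m 1).trans hn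
    have h3 : 3 ≤ n * (a - 1) := by
      rw [div_lt_iff₀ (sub_pos.2 ha)] at hm
      nlinarith
    push_cast
    nlinarith
  · have h0 := ENNReal.tendsto_atTop_zero_of_tsum_ne_top hx.ne
    have h1 := (ENNReal.tendsto_toReal ENNReal.zero_ne_top).comp h0
    simp only [Function.comp_def, ENNReal.toReal_ofReal (sq_nonneg _), ENNReal.toReal_zero] at h1
    have h2 := h1.sqrt
    simp only [Real.sqrt_sq_eq_abs, Real.sqrt_zero] at h2
    have h3 := ((tendsto_zero_iff_abs_tendsto_zero _).2 h2).add_const p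
    rw [zero_add] at h3
    refine h3.congr' ?_
    filter_upwards [eventually_gt_atTop 0] with n hn
    have : ((n ^ 2 : ℕ) : ℝ) ≠ 0 := by positivity
    simp only [hψ, Finset.sum_sub_distrib, Finset.sum_const, Finset.card_range, nsmul_eq_mul]
    field_simp
    ring

end Correlation

theorem monotoneOscLE_indicator_Ioi (c : ℝ) : MonotoneOscLE ((Ioi c).indicator 1) 1 := by
  refine .inl ⟨fun x _ y _ hxy => ?_, ?_⟩
  · by_cases hx : c < x
    · simp [hx, hx.trans_le hxy]
    · rw [indicator_of_notMem (by simpa using hx)]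
      exact indicator_nonneg (fun _ _ => zero_le_one) y
  · have h0 : (0 : ℝ) ≤ (Ioi c).indicator 1 0 := indicator_nonneg (fun _ _ => zero_le_one) _
    have h1 : (Ioi c).indicator 1 (1 : ℝ) ≤ (1 : ℝ) :=
      indicator_le_self' (fun _ _ => zero_le_one) _
    linarith

theorem indicator_one_mem_Icc (s : Set ℝ) (x : ℝ) : s.indicator 1 x ∈ Icc (0 : ℝ) 1 :=
  ⟨indicator_nonneg (fun _ _ => zero_le_one) x, indicator_le_self' (fun _ _ => zero_le_one) x⟩

theorem correlation_indicator_Ioc_le (hN : 0 < N) {a b : ℝ} (hab : a ≤ b) (n : ℕ) :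
    |∫ x, (Ioc a b).indicator 1 x * (Ioc a b).indicator 1 ((gaussT N)^[n] x) ∂gaussMeasure N -
      (∫ x, (Ioc a b).indicator (1 : ℝ → ℝ) x ∂gaussMeasure N) ^ 2| ≤ 2 / 2 ^ n := by
  have := isProbabilityMeasure_gaussMeasure hN
  have hm {s : Set ℝ} (hs : MeasurableSet s) : Measurable (s.indicator (1 : ℝ → ℝ)) :=
    measurable_one.indicator hs
  have hInt {s : Set ℝ} (hs : MeasurableSet s) :
      Integrable (s.indicator (1 : ℝ → ℝ)) (gaussMeasure N) :=
    (integrable_const 1).indicator hs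
  set φ : ℝ → ℝ := (Ioc a b).indicator 1 with hφ
  have hsplit (x : ℝ) : φ x = (Ioi a).indicator 1 x - (Ioi b).indicator 1 x := by
    rw [hφ, ← Ioi_sdiff_Ioi, indicator_sdiff (Ioi_subset_Ioi hab)]
    rfl
  have hmix (c : ℝ) := integral_mul_comp_iterate_sub_le hN (hm measurableSet_Ioc)
    (indicator_one_mem_Icc (Ioc a b)) n (hm measurableSet_Ioi)
    (fun z _ => indicator_one_mem_Icc (Ioi c) z) (monotoneOscLE_indicator_Ioi c)
  have hprod (c : ℝ) : Integrable
      (fun x => (Ioi c).indicator 1 x * φ ((gaussT N)^[n] x)) (gaussMeasure N) := by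
    refine (hInt measurableSet_Ioi).mul_bdd (c := 1) ((hm measurableSet_Ioc).comp
      (measurable_gaussT.iterate n)).aestronglyMeasurable (.of_forall fun x => ?_)
    have h := indicator_one_mem_Icc (Ioc a b) ((gaussT N)^[n] x)
    rw [Real.norm_of_nonneg h.1]
    exact h.2
  have h1 : ∫ x, φ x * φ ((gaussT N)^[n] x) ∂gaussMeasure N =
      ∫ x, (Ioi a).indicator 1 x * φ ((gaussT N)^[n] x) ∂gaussMeasure N -
        ∫ x, (Ioi b).indicator 1 x * φ ((gaussT N)^[n] x) ∂gaussMeasure N := by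
    rw [← integral_sub (hprod a) (hprod b)]
    exact integral_congr_ae (.of_forall fun x => by simp only [hsplit x, sub_mul])
  have h2 : ∫ x, φ x ∂gaussMeasure N =
      ∫ x, (Ioi a).indicator 1 x ∂gaussMeasure N - ∫ x, (Ioi b).indicator 1 x ∂gaussMeasure N := by
    rw [← integral_sub (hInt measurableSet_Ioi) (hInt measurableSet_Ioi)]
    exact integral_congr_ae (.of_forall hsplit)
  rw [sq, h1]
  nth_rewrite 1 [h2]
  calc _ = |(∫ x, (Ioi a).indicator 1 x * φ ((gaussT N)^[n] x) ∂gaussMeasure N -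
          (∫ x, (Ioi a).indicator 1 x ∂gaussMeasure N) * ∫ x, φ x ∂gaussMeasure N) -
        (∫ x, (Ioi b).indicator 1 x * φ ((gaussT N)^[n] x) ∂gaussMeasure N -
          (∫ x, (Ioi b).indicator 1 x ∂gaussMeasure N) * ∫ x, φ x ∂gaussMeasure N)| := by
        congr 1
        ring
    _ ≤ 1 / 2 ^ n + 1 / 2 ^ n := (abs_sub _ _).trans (add_le_add (hmix a) (hmix b))
    _ = 2 / 2 ^ n := by ring

/-- Almost every `gaussT N`-orbit visits `(a, b]` with frequency `gaussMeasure N (Ioc a b)`. -/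
theorem ae_tendsto_frequency_Ioc (hN : 0 < N) {a b : ℝ} (ha : 0 ≤ a) (hab : a ≤ b) (hb : b ≤ 1) :
    ∀ᵐ x ∂volume.restrict (Ico (0 : ℝ) 1), Tendsto (fun n : ℕ =>
      (∑ k ∈ Finset.range n, (Ioc a b).indicator (1 : ℝ → ℝ) ((gaussT N)^[k] x)) / n) atTop
      (nhds ((Real.log (b + N) - Real.log (a + N)) / (Real.log (N + 1) - Real.log N))) := by
  have := isProbabilityMeasure_gaussMeasure hN
  have hN' : (0 : ℝ) < N := by exact_mod_cast hN
  have h := ae_tendsto_average_of_correlation_le (measurePreserving_gaussT hN)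
    (measurable_one.indicator measurableSet_Ioc) (indicator_one_mem_Icc (Ioc a b))
    (correlation_indicator_Ioc_le hN hab)
  have hlog : Real.log (a + N) ≤ Real.log (b + N) := Real.log_le_log (by positivity) (by linarith)
  rw [integral_indicator_one measurableSet_Ioc, measureReal_def, gaussMeasure_Ioc hN ha hab hb,
    ENNReal.toReal_ofReal (div_nonneg (sub_nonneg.2 hlog) (log_add_one_sub_log_pos hN).le)] at h
  exact (volume_absolutelyContinuous_gaussMeasure hN).ae_le h

theorem floor_div_eq_iff_mem_Ioc {M : ℕ} (hN : 0 < N) (hM : 0 < M) (x : ℝ) :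
    ⌊(N : ℝ) / x⌋ = (M : ℤ) ↔ x ∈ Ioc ((N : ℝ) / (M + 1)) (N / M) := by
  have hN' : (0 : ℝ) < N := by exact_mod_cast hN
  have hM' : (0 : ℝ) < M := by exact_mod_cast hM
  rw [Int.floor_eq_iff, mem_Ioc, Int.cast_natCast]
  rcases le_or_gt x 0 with hx | hx
  · have h1 : (N : ℝ) / x ≤ 0 := div_nonpos_of_nonneg_of_nonpos hN'.le hx
    have h2 : (0 : ℝ) ≤ N / (M + 1) := by positivity
    constructor <;> intro h <;> linarith [h.1]
  · rw [le_div_iff₀ hx, div_lt_iff₀ hx, div_lt_iff₀ (by positivity), le_div_iff₀ hM',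
      mul_comm x, mul_comm x, and_comm]

/-- For every integer `M ≥ N`, for Lebesgue almost every `x ∈ [0,1)`, the frequency of
`M` among the `N`-continued fraction coefficients `a_k = ⌊N / T_N^[k-1] x⌋` of `x`
equals `(2 log (M+1) - log M - log (M+2)) / (log (N+1) - log N)`. -/
theorem gaussT_coeff_frequency (N M : ℕ) (hN : 0 < N) (hM : N ≤ M) :
    ∀ᵐ x ∂(volume.restrict (Set.Ico (0:ℝ) 1)),
      Tendsto (fun n : ℕ =>
          (((Finset.range n).filter
              (fun k => ⌊(N : ℝ) / (gaussT N)^[k] x⌋ = (M : ℤ))).card : ℝ) / n)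
        atTop
        (nhds ((2 * Real.log (M + 1) - Real.log M - Real.log (M + 2)) /
          (Real.log (N + 1) - Real.log N))) := by
  have hN' : (0 : ℝ) < N := by exact_mod_cast hN
  have hM0 : 0 < M := hN.trans_le hM
  have hM' : (0 : ℝ) < M := by exact_mod_cast hM0
  have hle : (N : ℝ) / M ≤ 1 := div_le_one_of_le₀ (by exact_mod_cast hM) hM'.le
  have hlog : Real.log (N / M + N) - Real.log (N / (M + 1) + N) =
      2 * Real.log (M + 1) - Real.log M - Real.log (M + 2) := by
    have h1 : (N : ℝ) / M + N = N * (M + 1) / M := by field_simp; ring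
    have h2 : (N : ℝ) / (M + 1) + N = N * (M + 2) / (M + 1) := by field_simp; ring
    rw [h1, h2, Real.log_div (by positivity) hM'.ne', Real.log_div (by positivity) (by positivity),
      Real.log_mul hN'.ne' (by positivity), Real.log_mul hN'.ne' (by positivity)]
    ring
  have h := ae_tendsto_frequency_Ioc hN (a := N / (M + 1)) (b := N / M) (by positivity)
    (by gcongr; linarith) hle
  rw [hlog] at h
  filter_upwards [h] with x hx
  convert hx using 3 with n
  simp_rw [floor_div_eq_iff_mem_Ioc hN hM0]
  rw [Finset.card_filter]
  push_cast
  exact Finset.sum_congr rfl fun k _ => by simp [indicator_apply]
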